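/- If an equation system S contains variables X and Y such that X ≻_m Y and the pair (Y,X) lies in the transitive closure of the union of the relations ∼ and ≻_m, then S has no E₀-unifier. -/

import Mathlib

/-- Terms built from variables, free constants, two multiplication symbols
`mul` (*) and `cmul` (⊛), a binary symbol `exp`, and a unary symbol `g`. -/
inductive Tm : Type
  | var : ℕ → Tm
  | const : ℕ → Tm
  | mul : Tm → Tm → Tm
  | cmul : Tm → Tm → Tm
  | exp : Tm → Tm → Tm
  | g : Tm → Tm

/-- The equational theory E₀: the smallest congruence on terms, closed under
substitution (hence the axioms are stated for arbitrary terms), generated by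
`exp(g(X),Y) = g(X ⊛ Y)` and `exp(X*Y,Z) = exp(X,Z) * exp(Y,Z)`. -/
inductive E0 : Tm → Tm → Prop
  | ax1 (x y : Tm) : E0 (.exp (.g x) y) (.g (.cmul x y))
  | ax2 (x y z : Tm) : E0 (.exp (.mul x y) z) (.mul (.exp x z) (.exp y z))
  | refl (t : Tm) : E0 t t
  | symm {s t : Tm} : E0 s t → E0 t s
  | trans {s t u : Tm} : E0 s t → E0 t u → E0 s u
  | mul_congr {a b c d : Tm} : E0 a b → E0 c d → E0 (.mul a c) (.mul b d)
  | cmul_congr {a b c d : Tm} : E0 a b → E0 c d → E0 (.cmul a c) (.cmul b d)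
  | exp_congr {a b c d : Tm} : E0 a b → E0 c d → E0 (.exp a c) (.exp b d)
  | g_congr {a b : Tm} : E0 a b → E0 (.g a) (.g b)

/-- A ground term contains no variables. -/
def Tm.Ground : Tm → Prop
  | .var _ => False
  | .const _ => True
  | .mul s t => s.Ground ∧ t.Ground
  | .cmul s t => s.Ground ∧ t.Ground
  | .exp s t => s.Ground ∧ t.Ground
  | .g t => t.Ground


/-- Flat right-hand sides of equations: a variable, or `g(V)`, `exp(V,W)`,
`V*W`, `V⊛W` with `V`, `W` variables. -/
inductive Flat : Type
  | var : ℕ → Flat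
  | g : ℕ → Flat
  | exp : ℕ → ℕ → Flat
  | mul : ℕ → ℕ → Flat
  | cmul : ℕ → ℕ → Flat
deriving DecidableEq

/-- An equation `U =? t` is a pair of a variable and a flat term. -/
abbrev Eqn : Type := ℕ × Flat

/-- An equation system is a finite set of equations. -/
abbrev Sys : Type := Finset Eqn

/-- Interpretation of a flat term under a substitution. -/
def Flat.toTm (σ : ℕ → Tm) : Flat → Tm
  | .var v => σ v
  | .g v => .g (σ v)
  | .exp v w => .exp (σ v) (σ w)
  | .mul v w => .mul (σ v) (σ w)
  | .cmul v w => .cmul (σ v) (σ w)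

/-- `σ` is an E₀-unifier of `S` iff `σ(U) =_{E₀} σ(t)` for each `U =? t` in `S`. -/
def IsUnifier (σ : ℕ → Tm) (S : Sys) : Prop :=
  ∀ e ∈ S, E0 (σ e.1) (Flat.toTm σ e.2)

/-- The variables occurring in a flat term. -/
def Flat.vars : Flat → Finset ℕ
  | .var v => {v}
  | .g v => {v}
  | .exp v w => {v, w}
  | .mul v w => {v, w}
  | .cmul v w => {v, w}

/-- A flat term is a non-variable term. -/
def Flat.NonVar : Flat → Prop
  | .var _ => False
  | _ => True

/-- `U ≻ V` iff `S` contains an equation `U =? t` with `t` a non-variable term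
containing `V`. -/
def Succ (S : Sys) (U V : ℕ) : Prop :=
  ∃ t : Flat, (U, t) ∈ S ∧ t.NonVar ∧ V ∈ t.vars

/-- `U ≻_b V` iff `S` contains an equation `U =? exp(V,W)`. -/
def SuccB (S : Sys) (U V : ℕ) : Prop :=
  ∃ W, (U, Flat.exp V W) ∈ S

/-- `U ≻_m V` iff `S` contains an equation `U =? V*W` or `U =? W*V`. -/
def SuccM (S : Sys) (U V : ℕ) : Prop :=
  ∃ W, (U, Flat.mul V W) ∈ S ∨ (U, Flat.mul W V) ∈ S

/-- `∼` is the reflexive-symmetric-transitive closure of `≻_b`. -/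
def Sim (S : Sys) : ℕ → ℕ → Prop :=
  Relation.EqvGen (SuccB S)

/-- The number of `*`-symbols of a term that are not below a `g`, a `⊛`, or the
exponent of an `exp`. -/
def Tm.mulCount : Tm → ℕ
  | .mul s t => s.mulCount + t.mulCount + 1
  | .exp s _ => s.mulCount
  | _ => 0

/-- `Tm.mulCount` is an invariant of `E₀`-equality. -/
theorem E0.mulCount_eq {s t : Tm} (h : E0 s t) : s.mulCount = t.mulCount := by
  induction h <;> simp_all [Tm.mulCount]

theorem IsUnifier.mulCount_eq_of_sim {σ : ℕ → Tm} {S : Sys} (hσ : IsUnifier σ S)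
    {U V : ℕ} (h : Sim S U V) : (σ U).mulCount = (σ V).mulCount := by
  induction h with
  | rel _ _ h =>
    obtain ⟨W, hW⟩ := h
    exact (hσ _ hW).mulCount_eq
  | refl _ => rfl
  | symm _ _ _ ih => exact ih.symm
  | trans _ _ _ _ _ ih₁ ih₂ => exact ih₁.trans ih₂

theorem IsUnifier.mulCount_lt_of_succM {σ : ℕ → Tm} {S : Sys} (hσ : IsUnifier σ S)
    {U V : ℕ} (h : SuccM S U V) : (σ V).mulCount < (σ U).mulCount := by
  obtain ⟨W, hW | hW⟩ := h <;>
  · have := (hσ _ hW).mulCount_eq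
    simp only [Flat.toTm, Tm.mulCount] at this
    omega

/-- If `S` contains variables `X`, `Y` with `X ≻_m Y` and `(Y,X)` in the
transitive closure of `∼ ∪ ≻_m`, then `S` has no E₀-unifier. -/
theorem no_unifier_of_prop_cycle (S : Sys) (X Y : ℕ)
    (h1 : SuccM S X Y)
    (h2 : Relation.TransGen (fun a b => Sim S a b ∨ SuccM S a b) Y X) :
    ¬ ∃ σ : ℕ → Tm, IsUnifier σ S := by
  rintro ⟨σ, hσ⟩
  have step {a b : ℕ} (h : Sim S a b ∨ SuccM S a b) :
      (σ b).mulCount ≤ (σ a).mulCount :=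
    h.elim (fun h => (hσ.mulCount_eq_of_sim h).ge) fun h => (hσ.mulCount_lt_of_succM h).le
  have hle : (σ X).mulCount ≤ (σ Y).mulCount := by
    clear h1
    induction h2 using Relation.TransGen.head_induction_on with
    | single h => exact step h
    | head h _ ih => exact ih.trans (step h)
  exact (hσ.mulCount_lt_of_succM h1).not_ge hle
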